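/- arXiv:1903.09789 — 12 statements merged into one kernel-verified Lean document; each statement's English description precedes it below -/
import Mathlib

section
/- Let G be a finite simple graph without isolated vertices and let f be a Roman dominating function on G of minimum weight γ_R(G), with V_2 = {v ∈ V(G) : f(v) = 2}. Then γ_qtR(G) ≤ γ_R(G) + |V_2|. -/
/-- A Roman dominating function: labels in {0,1,2}, and every vertex labeled 0
has a neighbor labeled 2. -/
def IsRDF {V : Type*} (G : SimpleGraph V) (f : V → ℕ) : Prop :=
  (∀ v, f v ≤ 2) ∧ ∀ u, f u = 0 → ∃ v, G.Adj u v ∧ f v = 2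

/-- A quasi-total Roman dominating function: an RDF such that every vertex labeled 2
has a neighbor with positive label. -/
def IsQTRDF {V : Type*} (G : SimpleGraph V) (f : V → ℕ) : Prop :=
  IsRDF G f ∧ ∀ x, f x = 2 → ∃ y, G.Adj x y ∧ 1 ≤ f y

/-- A total Roman dominating function: an RDF such that every vertex with positive label
has a neighbor with positive label. -/
def IsTRDF {V : Type*} (G : SimpleGraph V) (f : V → ℕ) : Prop :=
  IsRDF G f ∧ ∀ v, 1 ≤ f v → ∃ w, G.Adj v w ∧ 1 ≤ f w

/-- The Roman domination number. -/
noncomputable def gammaR {V : Type*} [Fintype V] (G : SimpleGraph V) : ℕ :=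
  sInf {w | ∃ f : V → ℕ, IsRDF G f ∧ ∑ v, f v = w}

/-- The quasi-total Roman domination number. -/
noncomputable def gammaQTR {V : Type*} [Fintype V] (G : SimpleGraph V) : ℕ :=
  sInf {w | ∃ f : V → ℕ, IsQTRDF G f ∧ ∑ v, f v = w}

/-- The total Roman domination number. -/
noncomputable def gammaTR {V : Type*} [Fintype V] (G : SimpleGraph V) : ℕ :=
  sInf {w | ∃ f : V → ℕ, IsTRDF G f ∧ ∑ v, f v = w}

/-- A dominating set: every vertex outside it has a neighbor in it. -/
def IsDomSet {V : Type*} (G : SimpleGraph V) (D : Finset V) : Prop :=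
  ∀ v ∉ D, ∃ u ∈ D, G.Adj v u

/-- The domination number. -/
noncomputable def gammaDom {V : Type*} [Fintype V] (G : SimpleGraph V) : ℕ :=
  sInf {n | ∃ D : Finset V, IsDomSet G D ∧ D.card = n}

/-- A total dominating set: every vertex has a neighbor in it. -/
def IsTotalDomSet {V : Type*} (G : SimpleGraph V) (D : Finset V) : Prop :=
  ∀ v, ∃ u ∈ D, G.Adj v u

/-- The total domination number. -/
noncomputable def gammaT {V : Type*} [Fintype V] (G : SimpleGraph V) : ℕ :=
  sInf {n | ∃ D : Finset V, IsTotalDomSet G D ∧ D.card = n}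

/-- A packing: a set of vertices whose closed neighborhoods are pairwise disjoint. -/
def IsPacking {V : Type*} (G : SimpleGraph V) (B : Finset V) : Prop :=
  ∀ u ∈ B, ∀ v ∈ B, u ≠ v →
    ∀ w, ¬ ((w = u ∨ G.Adj u w) ∧ (w = v ∨ G.Adj v w))

/-- The packing number. -/
noncomputable def packingNumber {V : Type*} [Fintype V] (G : SimpleGraph V) : ℕ :=
  sSup {n | ∃ B : Finset V, IsPacking G B ∧ B.card = n}

/-- Raising to `1` the `0`-labels on a set meeting the neighborhood of every vertex labeled `2`
turns a Roman dominating function into a quasi-total one. -/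
theorem IsRDF.isQTRDF_raise {V : Type*} [DecidableEq V] {G : SimpleGraph V} {f : V → ℕ}
    (hf : IsRDF G f) {S : Finset V} (hS : ∀ x, f x = 2 → ∃ y ∈ S, G.Adj x y) :
    IsQTRDF G (fun v => if f v = 0 ∧ v ∈ S then 1 else f v) := by
  refine ⟨⟨fun v => ?_, fun u hu => ?_⟩, fun x hx => ?_⟩
  · have := hf.1 v
    dsimp only
    split_ifs <;> omega
  · dsimp only at hu
    obtain ⟨v, huv, hv⟩ := hf.2 u (by split_ifs at hu; exact hu)
    exact ⟨v, huv, by simp [hv]⟩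
  · dsimp only at hx
    obtain ⟨y, hyS, hxy⟩ := hS x (by grind)
    refine ⟨y, hxy, ?_⟩
    by_cases hy : f y = 0
    · simp [hy, hyS]
    · simp [hy, Nat.one_le_iff_ne_zero]

theorem stmt1 {V : Type*} [Fintype V] (G : SimpleGraph V)
    (hniso : ∀ v : V, ∃ u, G.Adj v u)
    (f : V → ℕ) (hf : IsRDF G f) (hmin : ∑ v, f v = gammaR G) :
    gammaQTR G ≤ gammaR G + (Finset.univ.filter (fun v => f v = 2)).card := by
  classical
  choose n hn using hniso
  set T := Finset.univ.filter (fun v => f v = 2)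
  have hg : IsQTRDF G (fun v => if f v = 0 ∧ v ∈ T.image n then 1 else f v) :=
    hf.isQTRDF_raise fun x hx => ⟨n x, Finset.mem_image_of_mem n (by simp [T, hx]), hn x⟩
  calc gammaQTR G
      ≤ ∑ v, (if f v = 0 ∧ v ∈ T.image n then 1 else f v) := Nat.sInf_le ⟨_, hg, rfl⟩
    _ ≤ ∑ v, (f v + if v ∈ T.image n then 1 else 0) := by
        refine Finset.sum_le_sum fun v _ => ?_
        split_ifs <;> grind
    _ = gammaR G + (T.image n).card := by
        rw [Finset.sum_add_distrib, hmin, Finset.sum_ite_mem, Finset.univ_inter, Finset.card_eq_sum_ones]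
    _ ≤ gammaR G + T.card := Nat.add_le_add_left Finset.card_image_le _
end

section
/- Let G be a finite simple graph without isolated vertices and let f' be a quasi-total Roman dominating function on G of minimum weight γ_qtR(G), with V'_1 = {v ∈ V(G) : f'(v) = 1}. Then γ_tR(G) ≤ γ_qtR(G) + |V'_1|. -/
/-- Relabel by 1 the vertices labeled 0 that are chosen as neighbors of vertices labeled 1. -/
theorem IsQTRDF.exists_isTRDF_sum_le {V : Type*} [Fintype V] {G : SimpleGraph V}
    (hniso : ∀ v : V, ∃ u, G.Adj v u) {f : V → ℕ} (hf : IsQTRDF G f) :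
    ∃ g : V → ℕ, IsTRDF G g ∧
      ∑ v, g v ≤ ∑ v, f v + (Finset.univ.filter (fun v => f v = 1)).card := by
  classical
  choose c hc using hniso
  obtain ⟨⟨hle, hdom⟩, htwo⟩ := hf
  set S := (Finset.univ.filter (fun v => f v = 1)).image c with hS
  set g : V → ℕ := fun v => if v ∈ S then max (f v) 1 else f v with hg
  have hfg (v : V) : f v ≤ g v := by grind
  have hg_le (v : V) : g v ≤ 2 := by grind
  refine ⟨g, ⟨⟨hg_le, fun u hu => ?_⟩, fun v _ => ?_⟩, ?_⟩
  · obtain ⟨w, hw, hw2⟩ := hdom u (Nat.le_zero.mp (hu ▸ hfg u))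
    exact ⟨w, hw, le_antisymm (hg_le w) (hw2 ▸ hfg w)⟩
  · have hcases : f v = 0 ∨ f v = 1 ∨ f v = 2 := by have := hle v; lia
    rcases hcases with h | h | h
    · obtain ⟨w, hw, hw2⟩ := hdom v h
      exact ⟨w, hw, by have := hfg w; lia⟩
    · have hmem : c v ∈ S := Finset.mem_image_of_mem c (by simp [h])
      exact ⟨c v, hc v, by simp [hg, hmem]⟩
    · obtain ⟨w, hw, hw1⟩ := htwo v h
      exact ⟨w, hw, hw1.trans (hfg w)⟩
  · calc ∑ v, g v ≤ ∑ v, (f v + if v ∈ S then 1 else 0) :=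
          Finset.sum_le_sum fun v _ => by grind
      _ = ∑ v, f v + S.card := by simp [Finset.sum_add_distrib]
      _ ≤ _ := Nat.add_le_add_left Finset.card_image_le _

theorem stmt2 {V : Type*} [Fintype V] (G : SimpleGraph V)
    (hniso : ∀ v : V, ∃ u, G.Adj v u)
    (f : V → ℕ) (hf : IsQTRDF G f) (hmin : ∑ v, f v = gammaQTR G) :
    gammaTR G ≤ gammaQTR G + (Finset.univ.filter (fun v => f v = 1)).card := by
  obtain ⟨g, hg, hsum⟩ := hf.exists_isTRDF_sum_le hniso
  rw [← hmin]
  exact le_trans (Nat.sInf_le (show _ ∈ {w | _} from ⟨g, hg, rfl⟩)) hsum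
end

section
/- For every finite connected simple graph G with at least two vertices, γ_t(G) ≤ γ_qtR(G) ≤ 2γ_t(G). -/
/-- A QTRDF of a graph without isolated vertices yields a total dominating set whose cardinality
is at most the weight: the vertices labeled 2, and one neighbor of each vertex of positive label. -/
theorem IsQTRDF.exists_isTotalDomSet_card_le {V : Type*} [Fintype V] {G : SimpleGraph V}
    (hG : ∀ v, ∃ u, G.Adj v u) {f : V → ℕ} (hf : IsQTRDF G f) :
    ∃ D : Finset V, IsTotalDomSet G D ∧ D.card ≤ ∑ v, f v := by
  classical
  choose n hn using hG
  refine ⟨Finset.univ.filter (f · = 2) ∪ (Finset.univ.filter (1 ≤ f ·)).image n, ?_, ?_⟩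
  · intro v
    rcases Nat.eq_zero_or_pos (f v) with h | h
    · obtain ⟨u, huv, hu⟩ := hf.1.2 v h
      exact ⟨u, by simp [hu], huv⟩
    · exact ⟨n v, Finset.mem_union_right _ (Finset.mem_image_of_mem n
        (Finset.mem_filter.mpr ⟨Finset.mem_univ v, h⟩)), hn v⟩
  · calc
      _ ≤ (Finset.univ.filter (f · = 2)).card + (Finset.univ.filter (1 ≤ f ·)).card :=
        (Finset.card_union_le _ _).trans (Nat.add_le_add_left Finset.card_image_le _)
      _ ≤ ∑ v, f v := by
        rw [Finset.card_filter, Finset.card_filter, ← Finset.sum_add_distrib]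
        refine Finset.sum_le_sum fun v _ => ?_
        split_ifs <;> omega

/-- Labeling a total dominating set by 2 and its complement by 0 gives a QTRDF. -/
theorem IsTotalDomSet.isQTRDF_ite {V : Type*} [DecidableEq V] {G : SimpleGraph V} {D : Finset V}
    (hD : IsTotalDomSet G D) : IsQTRDF G fun v => if v ∈ D then 2 else 0 := by
  refine ⟨⟨fun v => by dsimp only; split_ifs <;> omega, fun u _ => ?_⟩, fun x _ => ?_⟩
  · obtain ⟨v, hv, huv⟩ := hD u
    exact ⟨v, huv, if_pos hv⟩
  · obtain ⟨y, hy, hxy⟩ := hD x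
    exact ⟨y, hxy, by simp [hy]⟩

theorem stmt3 {V : Type*} [Fintype V] (G : SimpleGraph V)
    (hconn : G.Connected) (hcard : 2 ≤ Fintype.card V) :
    gammaT G ≤ gammaQTR G ∧ gammaQTR G ≤ 2 * gammaT G := by
  classical
  have : Nontrivial V := Fintype.one_lt_card_iff_nontrivial.mp hcard
  have hG : ∀ v, ∃ u, G.Adj v u := hconn.preconnected.exists_adj_of_nontrivial
  have hne : {n | ∃ D : Finset V, IsTotalDomSet G D ∧ D.card = n}.Nonempty :=
    ⟨_, Finset.univ, fun v => (hG v).imp fun u hu => ⟨Finset.mem_univ u, hu⟩, rfl⟩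
  obtain ⟨D, hD, hDcard⟩ := Nat.sInf_mem hne
  have hsum : ∑ v, (if v ∈ D then 2 else 0) = 2 * gammaT G := by
    rw [gammaT, ← hDcard]
    simp [mul_comm]
  constructor
  · obtain ⟨f, hf, hw⟩ := Nat.sInf_mem
      (s := {w | ∃ f : V → ℕ, IsQTRDF G f ∧ ∑ v, f v = w}) ⟨_, _, hD.isQTRDF_ite, rfl⟩
    obtain ⟨E, hE, hEcard⟩ := hf.exists_isTotalDomSet_card_le hG
    calc
      gammaT G ≤ E.card := Nat.sInf_le ⟨E, hE, rfl⟩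
      _ ≤ ∑ v, f v := hEcard
      _ = gammaQTR G := hw
  · exact Nat.sInf_le ⟨_, hD.isQTRDF_ite, hsum⟩
end

section
/- Let G be a finite connected simple graph with at least two vertices. Then γ_qtR(G) = γ_t(G) if and only if G is isomorphic to the path P_2 (i.e., the complete graph on two vertices). -/
theorem gammaT_le_card {V : Type*} [Fintype V] {G : SimpleGraph V} {D : Finset V}
    (h : IsTotalDomSet G D) : gammaT G ≤ D.card :=
  Nat.sInf_le ⟨D, h, rfl⟩

theorem isQTRDF_one {V : Type*} (G : SimpleGraph V) : IsQTRDF G (fun _ => 1) := by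
  simp [IsQTRDF, IsRDF]

theorem exists_isQTRDF_sum_eq {V : Type*} [Fintype V] (G : SimpleGraph V) :
    ∃ f, IsQTRDF G f ∧ ∑ v, f v = gammaQTR G :=
  Nat.sInf_mem (s := {w | ∃ f : V → ℕ, IsQTRDF G f ∧ ∑ v, f v = w})
    ⟨_, _, isQTRDF_one G, rfl⟩

theorem exists_isTotalDomSet_card_eq {V : Type*} [Fintype V] {G : SimpleGraph V}
    {D : Finset V} (h : IsTotalDomSet G D) :
    ∃ E, IsTotalDomSet G E ∧ E.card = gammaT G :=
  Nat.sInf_mem (s := {n | ∃ D : Finset V, IsTotalDomSet G D ∧ D.card = n}) ⟨_, D, h, rfl⟩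

/-- In a connected graph on at least three vertices, deleting a non-cut vertex leaves a
total dominating set. -/
theorem gammaT_lt_card {V : Type*} [Fintype V] {G : SimpleGraph V}
    (hconn : G.Connected) (hcard : 3 ≤ Fintype.card V) : gammaT G < Fintype.card V := by
  classical
  have : Nontrivial V := Fintype.one_lt_card_iff_nontrivial.mp (by omega)
  obtain ⟨v, hv⟩ := hconn.exists_connected_induce_compl_singleton_of_finite_nontrivial
  have hc : ({v}ᶜ : Finset V).card = Fintype.card V - 1 := by
    rw [Finset.card_compl, Finset.card_singleton]
  have : Nontrivial ({v}ᶜ : Set V) := by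
    rw [Set.nontrivial_coe_sort]
    have h : 1 < ({v}ᶜ : Finset V).card := by omega
    simpa [Finset.Nontrivial] using Finset.one_lt_card_iff_nontrivial.mp h
  have hD : IsTotalDomSet G ({v}ᶜ : Finset V) := by
    intro x
    by_cases hx : x = v
    · obtain ⟨w, hw⟩ := hconn.preconnected.exists_adj_of_nontrivial x
      exact ⟨w, by simpa [← hx] using hw.ne', hw⟩
    · obtain ⟨w, hw⟩ := hv.preconnected.exists_adj_of_nontrivial ⟨x, hx⟩
      have hwv : (w : V) ≠ v := w.2
      exact ⟨w, by simpa using hwv, hw⟩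
  have := gammaT_le_card hD
  omega

/-- If some label is 2, then the vertices with positive label, after each one of them isolated
among the others is replaced by one of its neighbors, form a total dominating set. -/
theorem gammaT_lt_sum_of_eq_two {V : Type*} [Fintype V] {G : SimpleGraph V}
    (hadj : ∀ v, ∃ w, G.Adj v w) {f : V → ℕ} (hf : IsQTRDF G f) {a : V} (ha : f a = 2) :
    gammaT G < ∑ v, f v := by
  classical
  choose g hg using hadj
  let r : V → V := fun v => if ∃ w, G.Adj v w ∧ 1 ≤ f w then v else g v
  have hr {v w : V} (h : G.Adj v w) (hw : 1 ≤ f w) : r v = v := if_pos ⟨w, h, hw⟩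
  have hD : IsTotalDomSet G ((Finset.univ.filter (1 ≤ f ·)).image r) := by
    intro x
    by_cases hx0 : f x = 0
    · obtain ⟨y, hxy, hy⟩ := hf.1.2 x hx0
      obtain ⟨z, hyz, hz⟩ := hf.2 y hy
      exact ⟨y, Finset.mem_image.2 ⟨y, by simp [hy], hr hyz hz⟩, hxy⟩
    · have hx : 1 ≤ f x := by omega
      by_cases h : ∃ w, G.Adj x w ∧ 1 ≤ f w
      · obtain ⟨w, hxw, hw⟩ := h
        exact ⟨w, Finset.mem_image.2 ⟨w, by simpa using hw, hr hxw.symm hx⟩, hxw⟩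
      · exact ⟨g x, Finset.mem_image.2 ⟨x, by simpa using hx, if_neg h⟩, hg x⟩
  calc gammaT G ≤ ((Finset.univ.filter (1 ≤ f ·)).image r).card := gammaT_le_card hD
    _ ≤ (Finset.univ.filter (1 ≤ f ·)).card := Finset.card_image_le
    _ = ∑ v, if 1 ≤ f v then 1 else 0 := Finset.card_filter _ _
    _ < ∑ v, f v := by
      refine Finset.sum_lt_sum (fun v _ => ?_) ⟨a, Finset.mem_univ a, by simp [ha]⟩
      split_ifs <;> omega

theorem gammaT_lt_gammaQTR {V : Type*} [Fintype V] {G : SimpleGraph V}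
    (hconn : G.Connected) (hcard : 3 ≤ Fintype.card V) : gammaT G < gammaQTR G := by
  have : Nontrivial V := Fintype.one_lt_card_iff_nontrivial.mp (by omega)
  obtain ⟨f, hf, hsum⟩ := exists_isQTRDF_sum_eq G
  rw [← hsum]
  by_cases h2 : ∃ a, f a = 2
  · obtain ⟨a, ha⟩ := h2
    exact gammaT_lt_sum_of_eq_two hconn.preconnected.exists_adj_of_nontrivial hf ha
  · have h1 (v : V) : 1 ≤ f v := by
      by_contra! hv
      obtain ⟨w, _, hw⟩ := hf.1.2 v (by omega)
      exact h2 ⟨w, hw⟩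
    calc gammaT G < Fintype.card V := gammaT_lt_card hconn hcard
      _ = ∑ _v : V, 1 := by simp
      _ ≤ ∑ v, f v := Finset.sum_le_sum fun v _ => h1 v

theorem two_le_gammaQTR {V : Type*} [Fintype V] (G : SimpleGraph V)
    (hcard : 2 ≤ Fintype.card V) : 2 ≤ gammaQTR G := by
  obtain ⟨f, hf, hsum⟩ := exists_isQTRDF_sum_eq G
  rw [← hsum]
  by_cases h0 : ∃ u, f u = 0
  · obtain ⟨u, hu⟩ := h0
    obtain ⟨v, _, hv⟩ := hf.1.2 u hu
    exact hv ▸ Finset.single_le_sum (fun _ _ => Nat.zero_le _) (Finset.mem_univ v)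
  · push Not at h0
    calc 2 ≤ ∑ _v : V, 1 := by simpa using hcard
      _ ≤ ∑ v, f v := Finset.sum_le_sum fun v _ => Nat.one_le_iff_ne_zero.2 (h0 v)

theorem two_le_gammaT {V : Type*} [Fintype V] [Nonempty V] {G : SimpleGraph V}
    (hadj : ∀ v, ∃ w, G.Adj v w) : 2 ≤ gammaT G := by
  have huniv : IsTotalDomSet G Finset.univ := fun v => by simpa using hadj v
  obtain ⟨D, hD, hcard⟩ := exists_isTotalDomSet_card_eq huniv
  rw [← hcard]
  obtain ⟨v⟩ := ‹Nonempty V›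
  obtain ⟨a, ha, _⟩ := hD v
  obtain ⟨b, hb, hab⟩ := hD a
  exact Finset.one_lt_card.2 ⟨a, ha, b, hb, hab.ne⟩

theorem SimpleGraph.Connected.eq_top_of_card_eq_two {V : Type*} [Fintype V]
    {G : SimpleGraph V} (hconn : G.Connected) (hcard : Fintype.card V = 2) : G = ⊤ := by
  classical
  have : Nontrivial V := Fintype.one_lt_card_iff_nontrivial.mp (by omega)
  refine top_le_iff.mp fun u v huv => ?_
  obtain ⟨w, hw⟩ := hconn.preconnected.exists_adj_of_nontrivial u
  by_contra h
  have hvw : v ≠ w := fun e => h (e ▸ hw)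
  have h3 : ({u, v, w} : Finset V).card = 3 :=
    Finset.card_eq_three.2 ⟨u, v, w, huv, hw.ne, hvw, rfl⟩
  have := Finset.card_le_univ ({u, v, w} : Finset V)
  omega

theorem stmt4 {V : Type*} [Fintype V] (G : SimpleGraph V)
    (hconn : G.Connected) (hcard : 2 ≤ Fintype.card V) :
    gammaQTR G = gammaT G ↔ Nonempty (G ≃g (⊤ : SimpleGraph (Fin 2))) := by
  constructor
  · intro h
    have h2 : Fintype.card V = 2 := by
      by_contra hne
      have := gammaT_lt_gammaQTR hconn (by omega)
      omega
    obtain rfl := hconn.eq_top_of_card_eq_two h2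
    exact ⟨SimpleGraph.Iso.completeGraph (Fintype.equivFinOfCardEq h2)⟩
  · rintro ⟨e⟩
    have h2 : Fintype.card V = 2 := by simpa using Fintype.card_congr e.toEquiv
    have : Nontrivial V := Fintype.one_lt_card_iff_nontrivial.mp hcard
    have hadj := hconn.preconnected.exists_adj_of_nontrivial
    have hT := two_le_gammaT hadj
    have hQ := two_le_gammaQTR G hcard
    have hT' : gammaT G ≤ Finset.univ.card :=
      gammaT_le_card (G := G) fun v => by simpa using hadj v
    have hQ' : gammaQTR G ≤ ∑ _v : V, 1 := Nat.sInf_le ⟨_, isQTRDF_one G, rfl⟩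
    simp only [Finset.card_univ, Finset.sum_const, smul_eq_mul, mul_one] at hT' hQ'
    omega
end

section
/- Let G be a finite simple graph without isolated vertices, let f be a quasi-total Roman dominating function on G of minimum weight γ_qtR(G) with V_i = {v ∈ V(G) : f(v) = i} for i = 0,1,2, and let V*_{1,2} = {v ∈ V_1 : v has a neighbor in V_2}. Then γ(G) + |V_2| + |V*_{1,2}| ≤ γ_qtR(G). -/
theorem stmt7 {V : Type*} [Fintype V] (G : SimpleGraph V) [DecidableRel G.Adj]
    (hniso : ∀ v : V, ∃ u, G.Adj v u)
    (f : V → ℕ) (hf : IsQTRDF G f) (hmin : ∑ v, f v = gammaQTR G) :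
    gammaDom G + (Finset.univ.filter (fun v => f v = 2)).card +
      (Finset.univ.filter (fun v => f v = 1 ∧ ∃ u, G.Adj v u ∧ f u = 2)).card ≤
        gammaQTR G := by
  classical
  obtain ⟨⟨-, hzero⟩, -⟩ := hf
  set D : Finset V := Finset.univ.filter fun v =>
    f v ≠ 0 ∧ ¬ (f v = 1 ∧ ∃ u, G.Adj v u ∧ f u = 2) with hD
  have hdom : IsDomSet G D := by
    intro v hv
    have hnbr : ∃ u, G.Adj v u ∧ f u = 2 := by
      by_cases h0 : f v = 0
      · exact hzero v h0
      · simp only [hD, Finset.mem_filter, Finset.mem_univ, true_and] at hv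
        exact (not_not.mp fun h => hv ⟨h0, h⟩).2
    obtain ⟨u, hadj, hu⟩ := hnbr
    exact ⟨u, by simp [hD, hu], hadj⟩
  have hcard : gammaDom G ≤ D.card := Nat.sInf_le ⟨D, hdom, rfl⟩
  rw [← hmin]
  refine (Nat.add_le_add_right (Nat.add_le_add_right hcard _) _).trans ?_
  simp only [hD, Finset.card_filter]
  rw [← Finset.sum_add_distrib, ← Finset.sum_add_distrib]
  refine Finset.sum_le_sum fun v _ => ?_
  split_ifs <;> grind
end

section
/- For every finite simple graph G without isolated vertices, γ_qtR(G) ≤ 3γ(G). -/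
/-- Label a dominating set by 2 and one chosen neighbor of each of its vertices by 1. -/
theorem IsDomSet.exists_isQTRDF {V : Type*} [Fintype V] {G : SimpleGraph V}
    (hniso : ∀ v : V, ∃ u, G.Adj v u) {D : Finset V} (hD : IsDomSet G D) :
    ∃ f : V → ℕ, IsQTRDF G f ∧ ∑ v, f v ≤ 3 * D.card := by
  classical
  choose p hp using hniso
  let f : V → ℕ := fun v => if v ∈ D then 2 else if v ∈ D.image p then 1 else 0
  refine ⟨f, ⟨⟨fun v => ?_, fun u hu => ?_⟩, fun x hx => ⟨p x, hp x, ?_⟩⟩, ?_⟩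
  · dsimp only [f]
    split_ifs <;> omega
  · have hu' : u ∉ D := fun h => by simp [f, h] at hu
    obtain ⟨v, hv, huv⟩ := hD u hu'
    exact ⟨v, huv, by simp [f, hv]⟩
  · have hxD : x ∈ D := by
      by_contra h
      dsimp only [f] at hx
      rw [if_neg h] at hx
      split_ifs at hx
      omega
    have hpx : p x ∈ D.image p := Finset.mem_image_of_mem p hxD
    dsimp only [f]
    rw [if_pos hpx]
    split_ifs <;> omega
  · calc ∑ v, f v
        ≤ ∑ v, ((if v ∈ D then 2 else 0) + if v ∈ D.image p then 1 else 0) := by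
          refine Finset.sum_le_sum fun v _ => ?_
          dsimp only [f]
          split_ifs <;> omega
      _ = D.card * 2 + (D.image p).card := by
          rw [Finset.sum_add_distrib]
          simp only [Finset.sum_ite_mem, Finset.univ_inter, Finset.sum_const, smul_eq_mul,
            mul_one]
      _ ≤ 3 * D.card := by
          have := Finset.card_image_le (s := D) (f := p)
          omega

theorem stmt8 {V : Type*} [Fintype V] (G : SimpleGraph V)
    (hniso : ∀ v : V, ∃ u, G.Adj v u) :
    gammaQTR G ≤ 3 * gammaDom G := by
  obtain ⟨D, hD, hcard⟩ : gammaDom G ∈ {n | ∃ D : Finset V, IsDomSet G D ∧ D.card = n} :=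
    Nat.sInf_mem ⟨_, Finset.univ, fun v hv => absurd (Finset.mem_univ v) hv, rfl⟩
  obtain ⟨f, hf, hw⟩ := hD.exists_isQTRDF hniso
  rw [← hcard]
  exact le_trans (Nat.sInf_le ⟨f, hf, rfl⟩) hw
end

section
/- Let G be a finite simple graph of order n, and suppose G has q ≥ 1 distinct vertices v_1, v_2, …, v_q, each of degree greater than two, such that the distance in G between any two of them is at least three, and such that the set of vertices of G that are not adjacent to any vertex v_i (i ∈ {1,…,q}) is an independent set. Then γ_qtR(G) ≤ n + 3q − ∑_{i=1}^{q} (d_G(v_i) + 1). -/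
lemma gammaQTR_le_sum {V : Type*} [Fintype V] {G : SimpleGraph V} {f : V → ℕ}
    (hf : IsQTRDF G f) : gammaQTR G ≤ ∑ x, f x :=
  Nat.sInf_le ⟨f, hf, rfl⟩

lemma SimpleGraph.dist_le_two_of_adj_adj {V : Type*} {G : SimpleGraph V} {a b x : V}
    (ha : G.Adj a x) (hb : G.Adj b x) : G.dist a b ≤ 2 :=
  G.dist_le (.cons ha (.cons hb.symm .nil))

open Classical in
/-- Label 2 on the chosen centers `v i`, label 1 on the chosen neighbors `w i`, label 0 on the
other neighbors of centers, and label 1 on all remaining vertices. -/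
noncomputable def centerLabeling {V ι : Type*} (G : SimpleGraph V) (v w : ι → V) (x : V) : ℕ :=
  if ∃ i, x = v i then 2 else if ∃ i, x = w i then 1 else if ∃ i, G.Adj (v i) x then 0 else 1

lemma isQTRDF_centerLabeling {V ι : Type*} {G : SimpleGraph V} {v w : ι → V}
    (hw : ∀ i, G.Adj (v i) (w i)) : IsQTRDF G (centerLabeling G v w) := by
  have hv (i : ι) : centerLabeling G v w (v i) = 2 := if_pos ⟨i, rfl⟩
  refine ⟨⟨fun x => ?_, fun x hx => ?_⟩, fun x hx => ?_⟩
  · unfold centerLabeling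
    split_ifs <;> omega
  · unfold centerLabeling at hx
    split_ifs at hx with _ _ h
    obtain ⟨i, hi⟩ := h
    exact ⟨v i, hi.symm, hv i⟩
  · unfold centerLabeling at hx
    have h : ∃ i, x = v i := by
      split_ifs at hx with h
      · exact h
      all_goals omega
    obtain ⟨i, rfl⟩ := h
    refine ⟨w i, hw i, ?_⟩
    unfold centerLabeling
    split_ifs with _ h₁
    · omega
    · omega
    · exact absurd ⟨i, rfl⟩ h₁
    · omega

lemma centerLabeling_add_card_le {V ι : Type*} [Fintype ι] [DecidableEq V] {G : SimpleGraph V}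
    [DecidableRel G.Adj] {v w : ι → V}
    (hdist : ∀ i j, i ≠ j → 3 ≤ G.dist (v i) (v j)) (x : V) :
    centerLabeling G v w x + ∑ i, (if G.Adj (v i) x then 1 else 0) ≤
      1 + ∑ i, (if x = v i then 1 else 0) + ∑ i, (if x = w i then 1 else 0) := by
  have hone : ∑ i, (if G.Adj (v i) x then 1 else 0) ≤ 1 := by
    rw [Finset.sum_boole, Nat.cast_id, Finset.card_le_one]
    intro i hi j hj
    by_contra hij
    have := SimpleGraph.dist_le_two_of_adj_adj (Finset.mem_filter.1 hi).2 (Finset.mem_filter.1 hj).2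
    have := hdist i j hij
    omega
  have hpos (u : ι → V) (h : ∃ i, x = u i) : 1 ≤ ∑ i, (if x = u i then 1 else 0) := by
    obtain ⟨i, hi⟩ := h
    rw [Finset.sum_boole, Nat.cast_id]
    exact Finset.card_pos.2 ⟨i, by simpa using hi⟩
  have hzero (h : ∀ i, ¬ G.Adj (v i) x) : ∑ i, (if G.Adj (v i) x then 1 else 0) = 0 :=
    Finset.sum_eq_zero fun i _ => if_neg (h i)
  unfold centerLabeling
  split_ifs with h h₁ h₂
  · have := hpos v h
    obtain ⟨i, rfl⟩ := h
    have := hzero fun j hj => by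
      have hji : j ≠ i := by rintro rfl; exact hj.ne rfl
      have := hdist j i hji
      rw [SimpleGraph.dist_eq_one_iff_adj.2 hj] at this
      omega
    omega
  · have := hpos w h₁
    omega
  · omega
  · have := hzero fun i hi => h₂ ⟨i, hi⟩
    omega

theorem stmt9 {V : Type*} [Fintype V] (G : SimpleGraph V) [DecidableRel G.Adj]
    (q : ℕ) (hq : 1 ≤ q) (v : Fin q → V) (hinj : Function.Injective v)
    (hdeg : ∀ i, 2 < G.degree (v i))
    (hdist : ∀ i j, i ≠ j → 3 ≤ G.dist (v i) (v j))
    (hind : ∀ a b : V, (∀ i, ¬ G.Adj a (v i)) → (∀ i, ¬ G.Adj b (v i)) → ¬ G.Adj a b) :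
    (gammaQTR G : ℤ) ≤
      (Fintype.card V : ℤ) + 3 * q - ∑ i, ((G.degree (v i) : ℤ) + 1) := by
  classical
  have hnbr (i : Fin q) : ∃ x, G.Adj (v i) x :=
    (G.degree_pos_iff_exists_adj (v i)).1 (by have := hdeg i; omega)
  choose w hw using hnbr
  have hle := gammaQTR_le_sum (isQTRDF_centerLabeling hw)
  have hsum := Finset.sum_le_sum fun x (_ : x ∈ Finset.univ) =>
    centerLabeling_add_card_le (w := w) hdist x
  have hdegree (i : Fin q) : ∑ x, (if G.Adj (v i) x then 1 else 0) = G.degree (v i) := by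
    rw [Finset.sum_boole, Nat.cast_id, ← G.card_neighborFinset_eq_degree,
      G.neighborFinset_eq_filter]
  have hcount (u : Fin q → V) : ∑ x, ∑ i, (if x = u i then 1 else 0) = q := by
    rw [Finset.sum_comm]
    simp
  have hdegsum : ∑ x, ∑ i, (if G.Adj (v i) x then 1 else 0) = ∑ i, G.degree (v i) := by
    rw [Finset.sum_comm]
    exact Finset.sum_congr rfl fun i _ => hdegree i
  simp only [Finset.sum_add_distrib, hcount, hdegsum, Finset.sum_const, Finset.card_univ,
    smul_eq_mul, mul_one] at hsum
  simp only [Finset.sum_add_distrib, Finset.sum_const, Finset.card_univ, Fintype.card_fin,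
    nsmul_eq_mul, mul_one, ← Nat.cast_sum]
  omega
end

section
/- For every finite simple graph G of order n with maximum degree Δ(G) ≥ 2, γ_qtR(G) ≥ ⌈2n/Δ(G)⌉. -/
/-- The vertices labeled 0 by a QTRDF are covered by the neighborhoods of those labeled 2,
each of which contains at most `Δ - 1` of them. -/
theorem IsQTRDF.card_zero_le {V : Type*} [Fintype V] {G : SimpleGraph V} [DecidableRel G.Adj]
    {f : V → ℕ} (hf : IsQTRDF G f) :
    (Finset.univ.filter (f · = 0)).card ≤
      (Finset.univ.filter (f · = 2)).card * (G.maxDegree - 1) := by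
  classical
  obtain ⟨⟨-, hdom⟩, htot⟩ := hf
  refine le_trans (Finset.card_le_card ?_) (Finset.card_biUnion_le_card_mul
    (Finset.univ.filter (f · = 2)) (fun x => (G.neighborFinset x).filter (f · = 0)) _ ?_)
  · intro u hu
    have hu0 : f u = 0 := by simpa using hu
    obtain ⟨v, huv, hv⟩ := hdom u hu0
    simp only [Finset.mem_biUnion, Finset.mem_filter, Finset.mem_univ, true_and,
      SimpleGraph.mem_neighborFinset]
    exact ⟨v, hv, huv.symm, hu0⟩
  · intro x hx
    obtain ⟨y, hxy, hy⟩ := htot x (by simpa using hx)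
    have hlt : ((G.neighborFinset x).filter (f · = 0)).card < (G.neighborFinset x).card := by
      refine Finset.card_lt_card (Finset.filter_ssubset.2 ⟨y, ?_, by omega⟩)
      simpa using hxy
    have hdeg := G.degree_le_maxDegree x
    rw [SimpleGraph.card_neighborFinset_eq_degree] at hlt
    omega

theorem IsQTRDF.two_mul_card_le {V : Type*} [Fintype V] {G : SimpleGraph V}
    [DecidableRel G.Adj] {f : V → ℕ} (hf : IsQTRDF G f) (hΔ : 2 ≤ G.maxDegree) :
    2 * Fintype.card V ≤ G.maxDegree * ∑ v, f v := by
  have hzero := hf.card_zero_le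
  have hle := hf.1.1
  have hcard : Fintype.card V = (Finset.univ.filter (f · = 0)).card +
      (Finset.univ.filter (f · = 1)).card + (Finset.univ.filter (f · = 2)).card := by
    simp only [Finset.card_filter, ← Finset.sum_add_distrib]
    rw [← Finset.card_univ, Finset.card_eq_sum_ones]
    refine Finset.sum_congr rfl fun v _ => ?_
    have := hle v
    interval_cases f v <;> simp
  have hsum : ∑ v, f v = (Finset.univ.filter (f · = 1)).card +
      2 * (Finset.univ.filter (f · = 2)).card := by
    simp only [Finset.card_filter, Finset.mul_sum, ← Finset.sum_add_distrib]
    refine Finset.sum_congr rfl fun v _ => ?_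
    have := hle v
    interval_cases f v <;> simp
  rw [hcard, hsum]
  obtain ⟨d, hd⟩ := Nat.exists_eq_add_of_le hΔ
  rw [hd] at hzero ⊢
  rw [show 2 + d - 1 = d + 1 by omega] at hzero
  nlinarith [Nat.zero_le (d * (Finset.univ.filter (f · = 1)).card)]

theorem exists_isQTRDF_sum_eq_gammaQTR {V : Type*} [Fintype V] (G : SimpleGraph V) :
    ∃ f : V → ℕ, IsQTRDF G f ∧ ∑ v, f v = gammaQTR G :=
  Nat.sInf_mem (s := {w | ∃ f : V → ℕ, IsQTRDF G f ∧ ∑ v, f v = w})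
    ⟨_, fun _ => 1, by simp [IsQTRDF, IsRDF], rfl⟩

theorem stmt10 {V : Type*} [Fintype V] (G : SimpleGraph V) [DecidableRel G.Adj]
    (hΔ : 2 ≤ G.maxDegree) :
    ⌈(2 * (Fintype.card V : ℚ)) / (G.maxDegree : ℚ)⌉ ≤ (gammaQTR G : ℤ) := by
  obtain ⟨f, hf, hsum⟩ := exists_isQTRDF_sum_eq_gammaQTR G
  have h := hf.two_mul_card_le hΔ
  rw [hsum] at h
  have hpos : (0 : ℚ) < G.maxDegree := by exact_mod_cast (by omega : 0 < G.maxDegree)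
  rw [Int.ceil_le, div_le_iff₀ hpos, mul_comm _ (G.maxDegree : ℚ)]
  exact_mod_cast h
end

section
/- Let G be a finite connected simple graph of order n ≥ 3. Then γ_qtR(G) = 3 if and only if G has maximum degree n − 1. -/
/-- The maximum degree is `n - 1` exactly when some vertex is adjacent to all the others. -/
theorem maxDegree_eq_card_sub_one_iff {V : Type*} [Fintype V] [Nonempty V] (G : SimpleGraph V)
    [DecidableRel G.Adj] :
    G.maxDegree = Fintype.card V - 1 ↔ ∃ v, G.IsUniversal v := by
  classical
  have hne : ∀ v : V, (Finset.univ.erase v).card = Fintype.card V - 1 := fun v => by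
    rw [Finset.card_erase_of_mem (Finset.mem_univ v), Finset.card_univ]
  have hsub : ∀ v, G.neighborFinset v ⊆ Finset.univ.erase v := fun v u hu => by
    rw [SimpleGraph.mem_neighborFinset] at hu
    simpa using hu.ne'
  constructor
  · intro h
    obtain ⟨v, hv⟩ := G.exists_maximal_degree_vertex
    refine ⟨v, fun u hu => ?_⟩
    have heq := Finset.eq_of_subset_of_card_le (hsub v) (by
      rw [hne, ← h, hv, SimpleGraph.card_neighborFinset_eq_degree])
    rw [← SimpleGraph.mem_neighborFinset, heq]
    simpa using hu.symm
  · rintro ⟨v, hv⟩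
    have hlt := G.maxDegree_lt_card_verts
    have hle := G.degree_le_maxDegree v
    have hdeg : Fintype.card V - 1 ≤ G.degree v := by
      rw [← hne v, ← SimpleGraph.card_neighborFinset_eq_degree]
      refine Finset.card_le_card fun u hu => ?_
      rw [SimpleGraph.mem_neighborFinset]
      exact hv (by simpa [eq_comm] using hu)
    omega

/-- A connected graph of order three has a vertex of degree two. -/
theorem SimpleGraph.Connected.maxDegree_eq_two_of_card_eq_three {V : Type*} [Fintype V]
    {G : SimpleGraph V} [DecidableRel G.Adj] (hG : G.Connected) (hcard : Fintype.card V = 3) :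
    G.maxDegree = 2 := by
  classical
  have := hG.nonempty
  have hedge := hG.card_vert_le_card_edgeSet_add_one
  have hsum := G.sum_degrees_eq_twice_card_edges
  have hle : ∑ v, G.degree v ≤ ∑ _v : V, G.maxDegree :=
    Finset.sum_le_sum fun v _ => G.degree_le_maxDegree v
  have hlt := G.maxDegree_lt_card_verts
  rw [Finset.sum_const, Finset.card_univ, hcard, smul_eq_mul] at hle
  rw [Nat.card_eq_fintype_card, Nat.card_eq_fintype_card, ← SimpleGraph.edgeFinset_card] at hedge
  omega

/-- A quasi-total Roman dominating function without label 2 is constantly 1. -/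
theorem IsQTRDF.eq_one_of_forall_ne_two {V : Type*} {G : SimpleGraph V} {f : V → ℕ}
    (hf : IsQTRDF G f) (h : ∀ v, f v ≠ 2) (v : V) : f v = 1 := by
  have hle := hf.1.1 v
  have hne := h v
  have hpos : f v ≠ 0 := fun h0 =>
    have ⟨w, _, hw⟩ := hf.1.2 v h0
    h w hw
  omega

/-- A quasi-total Roman dominating function on a graph of order at least 3 has weight
at least 3. -/
theorem IsQTRDF.three_le_sum {V : Type*} [Fintype V] {G : SimpleGraph V} {f : V → ℕ}
    (hf : IsQTRDF G f) (hcard : 3 ≤ Fintype.card V) : 3 ≤ ∑ v, f v := by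
  classical
  by_cases h : ∃ v, f v = 2
  · obtain ⟨v, hv⟩ := h
    obtain ⟨y, hvy, hy⟩ := hf.2 v hv
    have hle := Finset.sum_le_univ_sum_of_nonneg (s := {v, y}) (f := f) fun _ => Nat.zero_le _
    rw [Finset.sum_pair hvy.ne] at hle
    omega
  · push Not at h
    simpa [hf.eq_one_of_forall_ne_two h] using hcard

/-- In a quasi-total Roman dominating function of weight 3, every vertex labeled 2 is
adjacent to all other vertices. -/
theorem IsQTRDF.isUniversal_of_sum_eq_three {V : Type*} [Fintype V] {G : SimpleGraph V} {f : V → ℕ}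
    (hf : IsQTRDF G f) (hsum : ∑ v, f v = 3) {v : V} (hv : f v = 2) :
    G.IsUniversal v := by
  classical
  intro u hu
  have hpair : ∀ a b, a ≠ b → f a + f b ≤ 3 := fun a b hab => by
    rw [← hsum, ← Finset.sum_pair hab]
    exact Finset.sum_le_univ_sum_of_nonneg fun _ => Nat.zero_le _
  obtain ⟨y, hvy, hy⟩ := hf.2 v hv
  by_cases huy : u = y
  · exact huy ▸ hvy
  have htriple : f v + (f y + f u) ≤ 3 := by
    rw [← hsum, ← Finset.sum_pair (Ne.symm huy), ← Finset.sum_insert (by simp [hvy.ne, hu])]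
    exact Finset.sum_le_univ_sum_of_nonneg fun _ => Nat.zero_le _
  obtain ⟨w, huw, hw⟩ := hf.1.2 u (by omega)
  have hwv : w = v := by
    by_contra hne
    have := hpair w v hne
    omega
  exact hwv ▸ huw.symm

/-- A vertex `v` adjacent to all others yields a quasi-total Roman dominating function of
weight 3, for any choice of a second vertex. -/
theorem exists_isQTRDF_sum_eq_three {V : Type*} [Fintype V] {G : SimpleGraph V} {v y : V}
    (hv : G.IsUniversal v) (hy : y ≠ v) :
    ∃ f : V → ℕ, IsQTRDF G f ∧ ∑ u, f u = 3 := by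
  classical
  refine ⟨fun u => (if u = v then 2 else 0) + if u = y then 1 else 0, ⟨⟨?_, ?_⟩, ?_⟩, ?_⟩
  · intro u
    dsimp only
    split_ifs <;> simp_all
  · intro u hu
    have huv : u ≠ v := by
      rintro rfl
      simp at hu
    exact ⟨v, (hv huv.symm).symm, by simp [hy.symm]⟩
  · intro x hx
    have hxv : x = v := by
      by_contra hne
      dsimp only at hx
      split_ifs at hx <;> simp_all
    exact ⟨y, hxv ▸ hv hy.symm, by simp⟩
  · simp [Finset.sum_add_distrib]

theorem stmt13 {V : Type*} [Fintype V] (G : SimpleGraph V) [DecidableRel G.Adj]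
    (hconn : G.Connected) (hcard : 3 ≤ Fintype.card V) :
    gammaQTR G = 3 ↔ G.maxDegree = Fintype.card V - 1 := by
  have := hconn.nonempty
  have hne : {w | ∃ f : V → ℕ, IsQTRDF G f ∧ ∑ v, f v = w}.Nonempty :=
    ⟨_, fun _ => 1, ⟨⟨by simp, by simp⟩, by simp⟩, rfl⟩
  constructor
  · intro h
    obtain ⟨f, hf, hsum⟩ := Nat.sInf_mem hne
    replace hsum : ∑ v, f v = 3 := hsum.trans h
    by_cases h2 : ∃ v, f v = 2
    · obtain ⟨v, hv⟩ := h2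
      exact (maxDegree_eq_card_sub_one_iff G).2
        ⟨v, hf.isUniversal_of_sum_eq_three hsum hv⟩
    · push Not at h2
      have hthree : Fintype.card V = 3 := by
        simpa [hf.eq_one_of_forall_ne_two h2] using hsum
      rw [hconn.maxDegree_eq_two_of_card_eq_three hthree, hthree]
  · intro h
    obtain ⟨v, hv⟩ := (maxDegree_eq_card_sub_one_iff G).1 h
    obtain ⟨y, hy⟩ := Fintype.exists_ne_of_one_lt_card (by omega) v
    refine le_antisymm (Nat.sInf_le (exists_isQTRDF_sum_eq_three hv hy)) (le_csInf hne ?_)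
    rintro _ ⟨f, hf, rfl⟩
    exact hf.three_le_sum hcard
end

section
/- For every finite connected simple graph G of order n with at least two vertices, γ_qtR(G) ≤ n − ρ(G)·(δ(G) − 2), where δ(G) is the minimum degree of G and ρ(G) is the packing number of G (the subtraction interpreted over the integers). -/
/-- The packing number is attained. -/
theorem exists_isPacking_card_eq_packingNumber {V : Type*} [Fintype V] (G : SimpleGraph V) :
    ∃ B : Finset V, IsPacking G B ∧ B.card = packingNumber G := by
  refine Nat.sSup_mem (s := {n | ∃ B : Finset V, IsPacking G B ∧ B.card = n})
    ⟨0, ∅, by simp [IsPacking], rfl⟩ ⟨Fintype.card V, ?_⟩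
  rintro _ ⟨B, -, rfl⟩
  exact B.card_le_univ

/-- A packing `B` in a graph without isolated vertices yields a quasi-total Roman dominating
function: label `B` with 2, one chosen neighbor of each vertex of `B` with 1, the other neighbors
of `B` with 0, and everything else with 1. -/
theorem IsPacking.exists_isQTRDF {V : Type*} [Fintype V] {G : SimpleGraph V}
    [DecidableRel G.Adj] {B : Finset V} (hB : IsPacking G B) (hnbr : ∀ v, ∃ w, G.Adj v w) :
    ∃ f : V → ℕ, IsQTRDF G f ∧
      ((∑ v, f v : ℕ) : ℤ) = Fintype.card V - ∑ b ∈ B, ((G.degree b : ℤ) - 2) := by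
  classical
  choose p hp using hnbr
  let Z : Finset V := B.biUnion fun b => (G.neighborFinset b).erase (p b)
  have mem_Z (v : V) : v ∈ Z ↔ ∃ b ∈ B, v ≠ p b ∧ G.Adj b v := by simp [Z]
  have notMem_Z {v : V} (hv : v ∈ B) : v ∉ Z := by
    rw [mem_Z]
    rintro ⟨b, hb, -, hbv⟩
    exact hB b hb v hv hbv.ne v ⟨.inr hbv, .inl rfl⟩
  have p_notMem_Z {v : V} (hv : v ∈ B) : p v ∉ Z := by
    rw [mem_Z]
    rintro ⟨b, hb, hne, hbv⟩
    exact hB b hb v hv (by rintro rfl; exact hne rfl) (p v) ⟨.inr hbv, .inr (hp v)⟩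
  have card_Z : (Z.card : ℤ) = ∑ b ∈ B, ((G.degree b : ℤ) - 1) := by
    rw [Finset.card_biUnion, Nat.cast_sum]
    · refine Finset.sum_congr rfl fun b _ => ?_
      have hmem : p b ∈ G.neighborFinset b := by simpa using hp b
      have hpos := Finset.card_pos.mpr ⟨_, hmem⟩
      rw [Finset.card_erase_of_mem hmem, Nat.cast_sub hpos, G.card_neighborFinset_eq_degree,
        Nat.cast_one]
    · intro u hu v hv huv
      refine Finset.disjoint_left.mpr fun w hwu hwv => ?_
      simp only [Finset.mem_erase, SimpleGraph.mem_neighborFinset] at hwu hwv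
      exact hB u hu v hv huv w ⟨.inr hwu.2, .inr hwv.2⟩
  let f : V → ℕ := fun v => if v ∈ B then 2 else if v ∈ Z then 0 else 1
  refine ⟨f, ⟨⟨fun v => ?_, fun u hu => ?_⟩, fun x hx => ?_⟩, ?_⟩
  · simp only [f]
    split_ifs <;> omega
  · have huZ : u ∈ Z := by
      by_contra h
      simp only [f, h, if_false] at hu
      split_ifs at hu
    obtain ⟨b, hb, -, hbu⟩ := (mem_Z u).mp huZ
    exact ⟨b, hbu.symm, by simp [f, hb]⟩
  · have hxB : x ∈ B := by
      by_contra h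
      simp only [f, h, if_false] at hx
      split_ifs at hx
      omega
    refine ⟨p x, hp x, ?_⟩
    simp only [f, p_notMem_Z hxB, if_false]
    split_ifs <;> omega
  · have hpoint (v : V) : f v + (if v ∈ Z then 1 else 0) = 1 + (if v ∈ B then 1 else 0) := by
      by_cases hv : v ∈ B
      · simp [f, hv, notMem_Z hv]
      · by_cases hz : v ∈ Z <;> simp [f, hv, hz]
    have hsum : ∑ v, f v + Z.card = Fintype.card V + B.card := by
      simpa [Finset.sum_add_distrib] using Finset.sum_congr (rfl : Finset.univ = Finset.univ)
        fun v _ => hpoint v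
    have hsumZ : ((∑ v, f v : ℕ) : ℤ) + Z.card = Fintype.card V + B.card := mod_cast hsum
    rw [card_Z] at hsumZ
    simp only [Finset.sum_sub_distrib, Finset.sum_const, nsmul_eq_mul] at hsumZ ⊢
    linarith

theorem stmt16 {V : Type*} [Fintype V] (G : SimpleGraph V) [DecidableRel G.Adj]
    (hconn : G.Connected) (hcard : 2 ≤ Fintype.card V) :
    (gammaQTR G : ℤ) ≤
      (Fintype.card V : ℤ) - (packingNumber G : ℤ) * ((G.minDegree : ℤ) - 2) := by
  have : Nontrivial V := Fintype.one_lt_card_iff_nontrivial.mp hcard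
  obtain ⟨B, hB, hBcard⟩ := exists_isPacking_card_eq_packingNumber G
  obtain ⟨f, hf, hweight⟩ := hB.exists_isQTRDF fun v =>
    hconn.preconnected.exists_adj_of_nontrivial v
  have hle : gammaQTR G ≤ ∑ v, f v := Nat.sInf_le ⟨f, hf, rfl⟩
  have hdeg : (B.card : ℤ) * ((G.minDegree : ℤ) - 2) ≤ ∑ b ∈ B, ((G.degree b : ℤ) - 2) := by
    rw [← nsmul_eq_mul]
    refine Finset.card_nsmul_le_sum _ _ _ fun b _ => ?_
    have := G.minDegree_le_degree b
    omega
  rw [hBcard] at hdeg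
  have : (gammaQTR G : ℤ) ≤ ((∑ v, f v : ℕ) : ℤ) := mod_cast hle
  linarith
end

section
/- Let G be a finite connected simple graph with at least two vertices that is an efficient domination graph, i.e., ρ(G) = γ(G). Then γ_qtR(G) ≤ 3ρ(G). -/
theorem exists_isDomSet_card_eq_gammaDom {V : Type*} [Fintype V] (G : SimpleGraph V) :
    ∃ D : Finset V, IsDomSet G D ∧ D.card = gammaDom G :=
  Nat.sInf_mem (s := {n | ∃ D : Finset V, IsDomSet G D ∧ D.card = n})
    ⟨_, Finset.univ, fun v hv => absurd (Finset.mem_univ v) hv, rfl⟩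

/-- In a graph without isolated vertices, labeling a dominating set by 2 and one neighbor of
each of its remaining vertices by 1 gives a quasi-total Roman dominating function. -/
theorem IsDomSet.gammaQTR_le {V : Type*} [Fintype V] {G : SimpleGraph V} {D : Finset V}
    (hD : IsDomSet G D) (hG : ∀ v, ∃ w, G.Adj v w) : gammaQTR G ≤ 3 * D.card := by
  classical
  choose g hg using hG
  let f : V → ℕ := fun v => if v ∈ D then 2 else if v ∈ D.image g then 1 else 0
  have hf : IsQTRDF G f := by
    refine ⟨⟨fun v => ?_, fun u hu => ?_⟩, fun x hx => ⟨g x, hg x, ?_⟩⟩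
    · dsimp only [f]
      split_ifs <;> omega
    · have huD : u ∉ D := fun h => by simp [f, h] at hu
      obtain ⟨v, hv, huv⟩ := hD u huD
      exact ⟨v, huv, if_pos hv⟩
    · have hxD : x ∈ D := by
        by_contra h
        dsimp only [f] at hx
        split_ifs at hx
        omega
      have hgx : g x ∈ D.image g := Finset.mem_image_of_mem g hxD
      dsimp only [f]
      split_ifs <;> omega
  have hsum : ∑ v, f v ≤ 3 * D.card := by
    calc ∑ v, f v
        ≤ ∑ v, ((if v ∈ D then 2 else 0) + if v ∈ D.image g then 1 else 0) := by
          refine Finset.sum_le_sum fun v _ => ?_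
          dsimp only [f]
          split_ifs <;> omega
      _ = D.card * 2 + (D.image g).card := by
          rw [Finset.sum_add_distrib, Finset.sum_ite_mem, Finset.sum_ite_mem]
          simp only [Finset.univ_inter, Finset.sum_const, smul_eq_mul, mul_one]
      _ ≤ 3 * D.card := by
          have := Finset.card_image_le (s := D) (f := g)
          omega
  exact le_trans (Nat.sInf_le ⟨f, hf, rfl⟩) hsum

theorem stmt17 {V : Type*} [Fintype V] (G : SimpleGraph V)
    (hconn : G.Connected) (hcard : 2 ≤ Fintype.card V)
    (heff : packingNumber G = gammaDom G) :
    gammaQTR G ≤ 3 * packingNumber G := by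
  have : Nontrivial V := Fintype.one_lt_card_iff_nontrivial.mp hcard
  obtain ⟨D, hD, hDcard⟩ := exists_isDomSet_card_eq_gammaDom G
  rw [heff, ← hDcard]
  exact hD.gammaQTR_le hconn.preconnected.exists_adj_of_nontrivial
end

section
/- Let G be a finite simple graph of order n ≥ 4 (not necessarily connected). Then γ_qtR(G) + γ_qtR(Ḡ) = n + 5 if and only if G is isomorphic to the cycle C_5. -/
theorem gammaQTR_le_card {V : Type*} [Fintype V] (G : SimpleGraph V) :
    gammaQTR G ≤ Fintype.card V :=
  Nat.sInf_le ⟨fun _ => 1, ⟨⟨by simp, by simp⟩, by simp⟩, by simp⟩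

/-- Labeling `T` by 2, `Z` by 0 and all other vertices by 1 bounds `gammaQTR` from above. -/
theorem gammaQTR_add_card_le {V : Type*} [Fintype V] (G : SimpleGraph V) (T Z : Finset V)
    (hTZ : Disjoint T Z) (hZ : ∀ z ∈ Z, ∃ t ∈ T, G.Adj z t)
    (hT : ∀ t ∈ T, ∃ y ∉ Z, G.Adj t y) :
    gammaQTR G + Z.card ≤ Fintype.card V + T.card := by
  classical
  let f : V → ℕ := fun x => if x ∈ T then 2 else if x ∈ Z then 0 else 1
  have hf : IsQTRDF G f := by
    refine ⟨⟨fun v => ?_, fun u hu => ?_⟩, fun x hx => ?_⟩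
    · dsimp only [f]; split_ifs <;> omega
    · have : u ∈ Z := by dsimp only [f] at hu; split_ifs at hu; assumption
      obtain ⟨t, ht, h⟩ := hZ u this
      exact ⟨t, h, by simp [f, ht]⟩
    · have : x ∈ T := by dsimp only [f] at hx; split_ifs at hx <;> first | assumption | omega
      obtain ⟨y, hy, h⟩ := hT x this
      exact ⟨y, h, by dsimp only [f]; split_ifs <;> omega⟩
  have hle : gammaQTR G ≤ ∑ v, f v := Nat.sInf_le ⟨f, hf, rfl⟩
  have hsum : ∑ v, f v + Z.card = Fintype.card V + T.card := by
    have h : ∀ x, f x + (if x ∈ Z then 1 else 0) = 1 + (if x ∈ T then 1 else 0) := by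
      intro x
      have : x ∈ T → x ∉ Z := fun h => Finset.disjoint_left.mp hTZ h
      dsimp only [f]; split_ifs <;> simp_all
    have := Finset.sum_congr (rfl : (Finset.univ : Finset V) = _) fun x _ => h x
    simpa [Finset.sum_add_distrib] using this
  omega

theorem gammaQTR_add_degree_le {V : Type*} [Fintype V] (G : SimpleGraph V) [DecidableRel G.Adj]
    {u v : V} (h : G.Adj v u) : gammaQTR G + G.degree v ≤ Fintype.card V + 2 := by
  classical
  have := gammaQTR_add_card_le G {v} ((G.neighborFinset v).erase u) (by simp)
    (fun z hz => ⟨v, by simp, by simp at hz; exact hz.2.symm⟩)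
    (fun t ht => ⟨u, by simp, by simp at ht; exact ht ▸ h⟩)
  rw [Finset.card_erase_of_mem (by simpa), G.card_neighborFinset_eq_degree,
    Finset.card_singleton] at this
  omega

theorem gammaQTR_add_card_union_le {V : Type*} [Fintype V] [DecidableEq V] (G : SimpleGraph V)
    [DecidableRel G.Adj] {u v : V} (h : G.Adj v u) :
    gammaQTR G + (G.neighborFinset v ∪ G.neighborFinset u).card ≤ Fintype.card V + 4 := by
  have := gammaQTR_add_card_le G {v, u} ((G.neighborFinset v ∪ G.neighborFinset u) \ {v, u})
    Finset.disjoint_sdiff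
    (fun z hz => by
      simp only [Finset.mem_sdiff, Finset.mem_union, SimpleGraph.mem_neighborFinset] at hz
      rcases hz.1 with hz | hz
      · exact ⟨v, by simp, hz.symm⟩
      · exact ⟨u, by simp, hz.symm⟩)
    (fun t ht => by
      simp only [Finset.mem_insert, Finset.mem_singleton] at ht
      rcases ht with rfl | rfl
      · exact ⟨u, by simp, h⟩
      · exact ⟨v, by simp, h.symm⟩)
  rw [Finset.card_sdiff_of_subset (by intro x; simp; rintro (rfl | rfl) <;> simp [h, h.symm]),
    Finset.card_pair h.ne] at this
  omega

theorem gammaQTR_eq_card_of_degree_le_two {V : Type*} [Fintype V] (G : SimpleGraph V)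
    [DecidableRel G.Adj] (h : ∀ v, G.degree v ≤ 2) : gammaQTR G = Fintype.card V := by
  classical
  refine le_antisymm (gammaQTR_le_card G)
    (le_csInf ⟨_, fun _ => 1, ⟨⟨by simp, by simp⟩, by simp⟩, rfl⟩ ?_)
  rintro _ ⟨f, ⟨⟨hf2, hf0⟩, hf⟩, rfl⟩
  have key := Finset.card_mul_le_card_mul G.Adj (s := {x | f x = 0}) (t := {x | f x = 2})
    (m := 1) (n := 1)
    (fun a ha => by
      obtain ⟨v, hv, hv2⟩ := hf0 a (by simpa using ha)
      exact Finset.card_pos.mpr ⟨v, by simp [Finset.mem_bipartiteAbove, hv, hv2]⟩)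
    (fun b hb => by
      obtain ⟨y, hy, hy1⟩ := hf b (by simpa using hb)
      have hsub : ({x | f x = 0} : Finset V).bipartiteBelow G.Adj b ⊆
          (G.neighborFinset b).erase y := by
        intro x hx
        simp only [Finset.mem_bipartiteBelow, Finset.mem_filter, Finset.mem_univ,
          true_and] at hx
        simp only [Finset.mem_erase, SimpleGraph.mem_neighborFinset]
        exact ⟨by rintro rfl; omega, hx.2.symm⟩
      have := Finset.card_le_card hsub
      rw [Finset.card_erase_of_mem (by simpa), G.card_neighborFinset_eq_degree] at this
      have := h b
      omega)
  have hsum : ∑ v, f v + ({x | f x = 0} : Finset V).card =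
      Fintype.card V + ({x | f x = 2} : Finset V).card := by
    have h : ∀ x, f x + (if f x = 0 then 1 else 0) = 1 + (if f x = 2 then 1 else 0) := by
      intro x
      have := hf2 x
      split_ifs <;> omega
    have := Finset.sum_congr (rfl : (Finset.univ : Finset V) = _) fun x _ => h x
    simpa [Finset.sum_add_distrib] using this
  omega

theorem nonempty_iso_cycleGraph_five {V : Type*} [Fintype V] (G : SimpleGraph V)
    [DecidableRel G.Adj] (hV : Fintype.card V = 5) (hdeg : ∀ v, G.degree v = 2)
    (hcommon : ∀ u w, u ≠ w → ¬ G.Adj u w → ∃ x, G.Adj u x ∧ G.Adj w x) :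
    Nonempty (G ≃g SimpleGraph.cycleGraph 5) := by
  classical
  have hnbr : ∀ x y, G.Adj x y → ∃ z, z ≠ y ∧ ∀ w, G.Adj x w ↔ w = y ∨ w = z := by
    intro x y hxy
    have hd := hdeg x
    rw [← G.card_neighborFinset_eq_degree, Finset.card_eq_two] at hd
    obtain ⟨p, q, hpq, hN⟩ := hd
    have hN' : ∀ w, G.Adj x w ↔ w = p ∨ w = q := fun w => by
      rw [← G.mem_neighborFinset, hN]; simp
    rcases (hN' y).1 hxy with rfl | rfl
    · exact ⟨q, hpq.symm, hN'⟩
    · exact ⟨p, hpq, fun w => (hN' w).trans or_comm⟩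
  have hext : ∀ S : Finset V, S.card ≤ 4 → ∃ w, w ∉ S := fun S hS => by
    by_contra! hall
    have := Finset.card_le_card (fun x _ => hall x : Finset.univ ⊆ S)
    rw [Finset.card_univ] at this
    omega
  obtain ⟨v, -⟩ := hext ∅ (by simp)
  obtain ⟨a, hva⟩ := G.degree_pos_iff_exists_adj v |>.1 (by simp [hdeg])
  obtain ⟨b, hba, hv⟩ := hnbr v a hva
  have hvb : G.Adj v b := (hv b).2 (Or.inr rfl)
  obtain ⟨c, hcv, ha⟩ := hnbr a v hva.symm
  obtain ⟨d, hdv, hb⟩ := hnbr b v hvb.symm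
  have hac : G.Adj a c := (ha c).2 (Or.inr rfl)
  have hbd : G.Adj b d := (hb d).2 (Or.inr rfl)
  have hcd : c ≠ d ∧ c ≠ b := by
    obtain ⟨w, hw⟩ := hext {v, a, b, c} Finset.card_le_four
    simp only [Finset.mem_insert, Finset.mem_singleton, not_or] at hw
    obtain ⟨x, hx, hwx⟩ := hcommon v w (Ne.symm hw.1) (by rw [hv]; tauto)
    have hxw := hwx.symm
    constructor <;> rintro rfl
    · rcases (hv x).1 hx with rfl | rfl
      · rw [ha] at hxw; tauto
      · rw [hb] at hxw; tauto
    · have := (hb a).1 hac.symm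
      have hne := hva.ne
      rcases (hv x).1 hx with rfl | rfl
      · rw [ha] at hxw; tauto
      · rw [hb] at hxw; grind
  obtain ⟨hcd, hcb⟩ := hcd
  have hda : d ≠ a := by
    rintro rfl
    rcases (ha b).1 hbd.symm with h | h
    · exact hvb.ne h.symm
    · exact hcb h.symm
  have hinj : Function.Injective ![v, a, c, d, b] := by
    have := hva.ne; have := hvb.ne; have := hac.ne; have := hbd.ne
    intro i j hij
    fin_cases i <;> fin_cases j <;> simp_all
  have hbij : Function.Bijective ![v, a, c, d, b] :=
    (Fintype.bijective_iff_injective_and_card _).2 ⟨hinj, by simp [hV]⟩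
  have hall : ∀ x, x = v ∨ x = a ∨ x = c ∨ x = d ∨ x = b := fun x => by
    obtain ⟨i, rfl⟩ := hbij.2 x
    fin_cases i <;> simp
  obtain ⟨x, hxa, hc⟩ := hnbr c a hac.symm
  have hcx : G.Adj c x := (hc x).2 (Or.inr rfl)
  have hxd : x = d := by
    rcases hall x with rfl | rfl | rfl | rfl | rfl
    · rcases (hv c).1 hcx.symm with h | h
      · exact absurd h hac.ne.symm
      · exact absurd h hcb
    · exact absurd rfl hxa
    · exact absurd hcx G.irrefl
    · rfl
    · rcases (hb c).1 hcx.symm with h | h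
      · exact absurd h hcv
      · exact absurd h hcd
  subst hxd
  obtain ⟨y, hyb, hd⟩ := hnbr x b hbd.symm
  have hyc : y = c := by
    rcases (hd c).1 hcx.symm with h | h
    · exact absurd h hcb
    · exact h.symm
  subst hyc
  refine ⟨RelIso.symm ⟨Equiv.ofBijective _ hbij, fun {i j} => ?_⟩⟩
  have := hva.ne; have := hvb.ne; have := hac.ne; have := hbd.ne
  rw [SimpleGraph.cycleGraph_adj]
  fin_cases i <;> fin_cases j <;> simp [hv, ha, hb, hc, hd] <;> grind

theorem nonempty_iso_cycleGraph_five_of_gammaQTR_add {V : Type*} [Fintype V] (G : SimpleGraph V)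
    (hcard : 4 ≤ Fintype.card V) (h : gammaQTR G + gammaQTR Gᶜ = Fintype.card V + 5) :
    Nonempty (G ≃g SimpleGraph.cycleGraph 5) := by
  classical
  have hG := gammaQTR_le_card G
  have hG' := gammaQTR_le_card Gᶜ
  have hcompl : ∀ v, Gᶜ.degree v + G.degree v + 1 = Fintype.card V := fun v => by
    have := G.degree_compl v
    have := G.degree_lt_card_verts v
    omega
  have hle : ∀ v, 0 < G.degree v → gammaQTR G + G.degree v ≤ Fintype.card V + 2 := fun v hv =>
    let ⟨_, hu⟩ := (G.degree_pos_iff_exists_adj v).1 hv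
    gammaQTR_add_degree_le G hu
  have hle' : ∀ v, 0 < Gᶜ.degree v → gammaQTR Gᶜ + Gᶜ.degree v ≤ Fintype.card V + 2 := fun v hv =>
    let ⟨_, hu⟩ := (Gᶜ.degree_pos_iff_exists_adj v).1 hv
    gammaQTR_add_degree_le Gᶜ hu
  obtain ⟨v⟩ : Nonempty V := Fintype.card_pos_iff.1 (by omega)
  have hreg : ∀ w, G.degree w = G.degree v := by
    have hmono : ∀ x y, G.degree x ≤ G.degree y := fun x y => by
      have := hle x; have := hle y; have := hle' x; have := hle' y
      have := hcompl x; have := hcompl y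
      omega
    exact fun w => le_antisymm (hmono _ _) (hmono _ _)
  set r := G.degree v with hr
  have hv := hle v
  have hv' := hle' v
  have hcv := hcompl v
  have hr2 : 2 ≤ r := by omega
  have hr2' : 2 ≤ Gᶜ.degree v := by omega
  have hcommon : ∀ u w, u ≠ w → ¬ G.Adj u w →
      r - 1 ≤ (G.neighborFinset u ∩ G.neighborFinset w).card := fun u w huw hadj => by
    have hB := gammaQTR_add_card_union_le Gᶜ (v := u) (u := w) ⟨huw, hadj⟩
    have heq : (Gᶜ.neighborFinset u ∪ Gᶜ.neighborFinset w)ᶜ =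
        G.neighborFinset u ∩ G.neighborFinset w := by
      ext x
      have hadj' : ¬ G.Adj w u := fun h => hadj h.symm
      by_cases hxu : x = u
      · subst hxu; simp [hadj', huw.symm]
      by_cases hxw : x = w
      · subst hxw; simp [hadj, huw]
      simp [Ne.symm hxu, Ne.symm hxw]
    rw [← heq, Finset.card_compl]
    omega
  have hcount := Finset.card_mul_le_card_mul G.Adj (s := Gᶜ.neighborFinset v)
    (t := G.neighborFinset v) (m := r - 1) (n := 1)
    (fun w hw => by
      simp only [SimpleGraph.mem_neighborFinset, SimpleGraph.compl_adj] at hw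
      refine (hcommon v w hw.1 hw.2).trans (Finset.card_le_card fun x hx => ?_)
      simpa [Finset.mem_bipartiteAbove] using hx)
    (fun u hu => by
      rw [SimpleGraph.mem_neighborFinset] at hu
      have hB := gammaQTR_add_card_union_le G hu
      have hsub : insert v (G.neighborFinset v) ∪
          (Gᶜ.neighborFinset v).bipartiteBelow G.Adj u ⊆
          G.neighborFinset v ∪ G.neighborFinset u := by
        intro x
        simp only [Finset.mem_union, Finset.mem_insert, Finset.mem_bipartiteBelow,
          SimpleGraph.mem_neighborFinset]
        rintro ((rfl | hx) | hx)
        · exact Or.inr hu.symm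
        · exact Or.inl hx
        · exact Or.inr hx.2.symm
      have hdisj : Disjoint (insert v (G.neighborFinset v))
          ((Gᶜ.neighborFinset v).bipartiteBelow G.Adj u) := by
        rw [Finset.disjoint_left]
        intro x hx hx'
        simp only [Finset.mem_insert, Finset.mem_bipartiteBelow,
          SimpleGraph.mem_neighborFinset, SimpleGraph.compl_adj] at hx hx'
        rcases hx with rfl | hx
        · exact hx'.1.1 rfl
        · exact hx'.1.2 hx
      have := Finset.card_le_card hsub
      rw [Finset.card_union_of_disjoint hdisj, Finset.card_insert_of_notMem (by simp),
        G.card_neighborFinset_eq_degree] at this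
      omega)
  rw [G.card_neighborFinset_eq_degree, Gᶜ.card_neighborFinset_eq_degree, ← hr] at hcount
  have hr_eq : r = 2 := by
    have := Nat.mul_le_mul_right (r - 1) hr2'
    omega
  rw [hr_eq] at hcount
  refine nonempty_iso_cycleGraph_five G (by omega) (fun w => (hreg w).trans hr_eq)
    fun u w huw hadj => ?_
  obtain ⟨x, hx⟩ := Finset.card_pos.1 (lt_of_lt_of_le (by omega) (hcommon u w huw hadj))
  exact ⟨x, by simpa using hx⟩

theorem stmt19 {V : Type*} [Fintype V] (G : SimpleGraph V)
    (hcard : 4 ≤ Fintype.card V) :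
    gammaQTR G + gammaQTR Gᶜ = Fintype.card V + 5 ↔
      Nonempty (G ≃g SimpleGraph.cycleGraph 5) := by
  refine ⟨nonempty_iso_cycleGraph_five_of_gammaQTR_add G hcard, ?_⟩
  rintro ⟨e⟩
  classical
  have hV : Fintype.card V = 5 := by simpa using Fintype.card_congr e.toEquiv
  have hdeg : ∀ v, G.degree v = 2 := fun v => by
    rw [← e.degree_eq v, SimpleGraph.cycleGraph_degree_three_le]
  rw [gammaQTR_eq_card_of_degree_le_two G fun v => (hdeg v).le,
    gammaQTR_eq_card_of_degree_le_two Gᶜ fun v => by rw [G.degree_compl, hdeg, hV], hV]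
end
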